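/- arXiv:2302.11024 — 2 statements merged into one kernel-verified Lean document; each statement's English description precedes it below -/
import Mathlib

section
/- Let A ∈ ℝ^{d×d} be invertible, b ∈ ℝ^d, and φ(θ) = Aθ + b. Let P and h assign to each θ ∈ ℝ^d and each positive probability density ρ on ℝ^d matrices P(θ,ρ), h(θ,ρ) ∈ ℝ^{d×d}, with θ ↦ h(θ,ρ) continuously differentiable for each ρ, and assume the transformation laws P(φ(θ), φ#ρ) = A·P(θ,ρ)·Aᵀ and h(φ(θ), φ#ρ) = A·h(θ,ρ) for all θ and ρ. Define D(θ,ρ) := (1/2)·h(θ,ρ)·h(θ,ρ)ᵀ, d(θ,ρ) ∈ ℝ^d with i-th entry Σ_j ∂_{θ_j} D(θ,ρ)_{ij}, and for continuously differentiable positive probability densities ρ, q the drift f(θ; ρ, q) := P(θ,ρ)·∇log q(θ) + (D(θ,ρ) − P(θ,ρ))·∇log ρ(θ) + d(θ,ρ). Then for every θ and every pair of continuously differentiable positive probability densities ρ, ρ_post, A·f(θ; ρ, ρ_post) = f(φ(θ); φ#ρ, φ#ρ_post); i.e. the mean-field drift of the preconditioned Wasserstein gradient flow is affine invariant. -/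
open MeasureTheory

/-- The gradient of a scalar field on `ℝ^d`, as the vector of partial derivatives. -/
noncomputable def gradv {d : ℕ} (f : (Fin d → ℝ) → ℝ) (θ : Fin d → ℝ) : Fin d → ℝ :=
  fun i => fderiv ℝ f θ (Pi.single i 1)

/-- An everywhere-positive probability density on `ℝ^d`. -/
def IsPosDensity {d : ℕ} (ρ : (Fin d → ℝ) → ℝ) : Prop :=
  (∀ θ, 0 < ρ θ) ∧ (∫ θ, ρ θ) = 1

/-- Pushforward of a density under the invertible affine map `θ ↦ Aθ + b`. -/
noncomputable def pushfwd {d : ℕ} (A : Matrix (Fin d) (Fin d) ℝ) (b : Fin d → ℝ)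
    (ρ : (Fin d → ℝ) → ℝ) : (Fin d → ℝ) → ℝ :=
  fun θ' => ρ (A⁻¹.mulVec (θ' - b)) * |A.det|⁻¹

theorem sum_smul_inv_mulVec_single {d : ℕ} {A : Matrix (Fin d) (Fin d) ℝ}
    (hA : IsUnit A.det) (i : Fin d) :
    ∑ j, A j i • A⁻¹.mulVec (Pi.single j 1) = Pi.single i (1 : ℝ) := by
  funext k
  have := congrFun (congrFun (Matrix.nonsing_inv_mul A hA) k) i
  rw [Matrix.mul_apply] at this
  simp [Finset.sum_apply, Pi.single_apply, ← Matrix.one_apply, ← this, mul_comm]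

/-- Chain rule along the inverse of the affine map `θ ↦ Aθ + b`. -/
theorem hasFDerivAt_comp_affine_inv {d : ℕ} {A : Matrix (Fin d) (Fin d) ℝ}
    (hA : IsUnit A.det) (b θ : Fin d → ℝ) {g : (Fin d → ℝ) → ℝ}
    (hg : DifferentiableAt ℝ g θ) :
    HasFDerivAt (fun x => g (A⁻¹.mulVec (x - b)))
      ((fderiv ℝ g θ).comp (LinearMap.toContinuousLinearMap (Matrix.mulVecLin A⁻¹)))
      (A.mulVec θ + b) := by
  have hinv : A⁻¹.mulVec (A.mulVec θ + b - b) = θ := by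
    rw [add_sub_cancel_right, Matrix.mulVec_mulVec, Matrix.nonsing_inv_mul _ hA,
      Matrix.one_mulVec]
  have h1 : HasFDerivAt (fun x => A⁻¹.mulVec (x - b))
      (LinearMap.toContinuousLinearMap (Matrix.mulVecLin A⁻¹)) (A.mulVec θ + b) :=
    (LinearMap.toContinuousLinearMap (Matrix.mulVecLin A⁻¹)).hasFDerivAt.comp
      (A.mulVec θ + b) ((hasFDerivAt_id (A.mulVec θ + b)).sub_const b)
  have h2 : HasFDerivAt g (fderiv ℝ g θ) (A⁻¹.mulVec (A.mulVec θ + b - b)) := by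
    rw [hinv]; exact hg.hasFDerivAt
  exact HasFDerivAt.comp (f := fun x => A⁻¹.mulVec (x - b)) (A.mulVec θ + b) h2 h1

theorem transpose_mulVec_gradv_log_pushfwd {d : ℕ} {A : Matrix (Fin d) (Fin d) ℝ}
    (hA : IsUnit A.det) (b θ : Fin d → ℝ) {ρ : (Fin d → ℝ) → ℝ}
    (hpos : ∀ x, 0 < ρ x) (hρ : ContDiff ℝ 1 ρ) :
    A.transpose.mulVec (gradv (fun x => Real.log (pushfwd A b ρ x)) (A.mulVec θ + b)) =
      gradv (fun x => Real.log (ρ x)) θ := by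
  have hlog : (fun x => Real.log (pushfwd A b ρ x)) =
      fun x => Real.log (ρ (A⁻¹.mulVec (x - b))) + Real.log |A.det|⁻¹ := by
    funext x
    exact Real.log_mul (hpos _).ne' (inv_ne_zero (abs_ne_zero.mpr hA.ne_zero))
  have hd : DifferentiableAt ℝ (fun x => Real.log (ρ x)) θ :=
    ((hρ.differentiable one_ne_zero) θ).log (hpos θ).ne'
  have hF := (hasFDerivAt_comp_affine_inv hA b θ hd).add_const (Real.log |A.det|⁻¹)
  funext i
  simp only [Matrix.mulVec, dotProduct, gradv, Matrix.transpose_apply]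
  rw [hlog, hF.fderiv, ← sum_smul_inv_mulVec_single hA i, map_sum]
  simp

theorem divergence_conj_affine {d : ℕ} {A : Matrix (Fin d) (Fin d) ℝ}
    (hA : IsUnit A.det) (b θ : Fin d → ℝ) {D : (Fin d → ℝ) → Matrix (Fin d) (Fin d) ℝ}
    (hD : ∀ i j, DifferentiableAt ℝ (fun x => D x i j) θ) (i : Fin d) :
    ∑ j, fderiv ℝ (fun x => (A * D (A⁻¹.mulVec (x - b)) * A.transpose) i j)
        (A.mulVec θ + b) (Pi.single j 1) =
      ∑ k, A i k * ∑ l, fderiv ℝ (fun x => D x k l) θ (Pi.single l 1) := by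
  have hF (j : Fin d) : HasFDerivAt
      (fun x => (A * D (A⁻¹.mulVec (x - b)) * A.transpose) i j)
      (∑ l, ∑ k, (A i k * A j l) • ((fderiv ℝ (fun x => D x k l) θ).comp
        (LinearMap.toContinuousLinearMap (Matrix.mulVecLin A⁻¹)))) (A.mulVec θ + b) := by
    have heq : (fun x => (A * D (A⁻¹.mulVec (x - b)) * A.transpose) i j) =
        fun x => ∑ l, ∑ k, A i k * A j l * D (A⁻¹.mulVec (x - b)) k l := by
      funext x
      simp only [Matrix.mul_apply, Matrix.transpose_apply, Finset.sum_mul]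
      refine Finset.sum_congr rfl fun l _ => Finset.sum_congr rfl fun k _ => ?_
      ring
    rw [heq]
    exact HasFDerivAt.fun_sum (u := Finset.univ) fun l _ =>
      HasFDerivAt.fun_sum (u := Finset.univ) fun k _ =>
      (hasFDerivAt_comp_affine_inv hA b θ (hD k l)).const_mul (A i k * A j l)
  simp only [fun j => (hF j).fderiv]
  calc _ = ∑ j, ∑ l, ∑ k, A i k *
        (A j l * fderiv ℝ (fun x => D x k l) θ (A⁻¹.mulVec (Pi.single j 1))) := by
        simp [mul_assoc]
    _ = ∑ k, ∑ l, ∑ j, A i k *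
        (A j l * fderiv ℝ (fun x => D x k l) θ (A⁻¹.mulVec (Pi.single j 1))) := by
        rw [Finset.sum_comm, Finset.sum_congr rfl fun l _ => Finset.sum_comm]
        exact Finset.sum_comm
    _ = _ := by
        refine Finset.sum_congr rfl fun k _ => ?_
        rw [Finset.mul_sum]
        refine Finset.sum_congr rfl fun l _ => ?_
        rw [← Finset.mul_sum, ← sum_smul_inv_mulVec_single hA l, map_sum]
        simp only [map_smul, smul_eq_mul]

/-- Affine invariance of the mean-field drift
`f(θ;ρ,q) = P ∇log q + (D − P) ∇log ρ + d` of the preconditioned Wasserstein gradient flow,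
where `D = ½ h hᵀ` and `d = ∇·D`, under the transformation laws
`P(φ(θ),φ#ρ) = A P(θ,ρ) Aᵀ` and `h(φ(θ),φ#ρ) = A h(θ,ρ)` for `φ(θ) = Aθ + b`. -/
theorem wasserstein_meanfield_drift_affine_invariant {d : ℕ}
    (A : Matrix (Fin d) (Fin d) ℝ) (hA : IsUnit A.det) (b : Fin d → ℝ)
    (P h : (Fin d → ℝ) → ((Fin d → ℝ) → ℝ) → Matrix (Fin d) (Fin d) ℝ)
    (hhC1 : ∀ ρ, IsPosDensity ρ → ∀ i j, ContDiff ℝ 1 (fun θ => h θ ρ i j))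
    (hP : ∀ θ ρ, IsPosDensity ρ →
      P (A.mulVec θ + b) (pushfwd A b ρ) = A * P θ ρ * A.transpose)
    (hh : ∀ θ ρ, IsPosDensity ρ →
      h (A.mulVec θ + b) (pushfwd A b ρ) = A * h θ ρ)
    (D : (Fin d → ℝ) → ((Fin d → ℝ) → ℝ) → Matrix (Fin d) (Fin d) ℝ)
    (hD : ∀ θ ρ, D θ ρ = (1 / 2 : ℝ) • (h θ ρ * (h θ ρ).transpose))
    (dv : (Fin d → ℝ) → ((Fin d → ℝ) → ℝ) → (Fin d → ℝ))
    (hdv : ∀ θ ρ i, dv θ ρ i = ∑ j, fderiv ℝ (fun x => D x ρ i j) θ (Pi.single j 1))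
    (f : (Fin d → ℝ) → ((Fin d → ℝ) → ℝ) → ((Fin d → ℝ) → ℝ) → (Fin d → ℝ))
    (hf : ∀ θ ρ q, f θ ρ q =
      (P θ ρ).mulVec (gradv (fun x => Real.log (q x)) θ) +
        (D θ ρ - P θ ρ).mulVec (gradv (fun x => Real.log (ρ x)) θ) + dv θ ρ) :
    ∀ (θ : Fin d → ℝ) (ρ ρpost : (Fin d → ℝ) → ℝ),
      IsPosDensity ρ → ContDiff ℝ 1 ρ → IsPosDensity ρpost → ContDiff ℝ 1 ρpost →
      A.mulVec (f θ ρ ρpost) = f (A.mulVec θ + b) (pushfwd A b ρ) (pushfwd A b ρpost) := by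
  intro θ ρ ρpost hρ hρ1 hq hq1
  have hφ (x : Fin d → ℝ) : A.mulVec (A⁻¹.mulVec (x - b)) + b = x := by
    rw [Matrix.mulVec_mulVec, Matrix.mul_nonsing_inv _ hA, Matrix.one_mulVec, sub_add_cancel]
  have hDφ (y : Fin d → ℝ) :
      D (A.mulVec y + b) (pushfwd A b ρ) = A * D y ρ * A.transpose := by
    rw [hD, hD, hh y ρ hρ, Matrix.transpose_mul]
    simp [Matrix.mul_assoc]
  have hDinv (x : Fin d → ℝ) :
      D x (pushfwd A b ρ) = A * D (A⁻¹.mulVec (x - b)) ρ * A.transpose := by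
    rw [← hDφ, hφ]
  have hDdiff (i j : Fin d) : DifferentiableAt ℝ (fun x => D x ρ i j) θ := by
    have hh_diff (i j : Fin d) : DifferentiableAt ℝ (fun x => h x ρ i j) θ :=
      (hhC1 ρ hρ i j).differentiable one_ne_zero θ
    simp only [hD, Matrix.smul_apply, Matrix.mul_apply, Matrix.transpose_apply]
    fun_prop
  have hdiv : dv (A.mulVec θ + b) (pushfwd A b ρ) = A.mulVec (dv θ ρ) := by
    funext i
    rw [hdv]
    simp only [hDinv, Matrix.mulVec, dotProduct, hdv]
    exact divergence_conj_affine hA b θ hDdiff i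
  rw [hf, hf, hdiv, hP θ ρ hρ, hDφ, ← Matrix.sub_mul, ← Matrix.mul_sub,
    ← Matrix.mulVec_mulVec _ _ A.transpose, ← Matrix.mulVec_mulVec _ _ A.transpose,
    transpose_mulVec_gradv_log_pushfwd hA b θ hq.1 hq1,
    transpose_mulVec_gradv_log_pushfwd hA b θ hρ.1 hρ1,
    Matrix.mulVec_add, Matrix.mulVec_add, Matrix.mulVec_mulVec, Matrix.mulVec_mulVec]
end

section
/- Let A ∈ ℝ^{d×d} be invertible, b ∈ ℝ^d, and φ(θ) = Aθ + b. Let κ assign to each pair θ, θ' ∈ ℝ^d and each positive probability density ρ a real number κ(θ,θ',ρ), and let P assign a matrix P(θ,θ',ρ) ∈ ℝ^{d×d}; assume the transformation law κ(φ(θ), φ(θ'), φ#ρ)·P(φ(θ), φ(θ'), φ#ρ) = κ(θ,θ',ρ)·A·P(θ,θ',ρ)·Aᵀ for all θ, θ', ρ. Let ρ_post be a twice continuously differentiable positive probability density and ρ : ℝ × ℝ^d → (0,∞) with each ρ_t := ρ(t,·) a continuously differentiable positive probability density and t ↦ ρ(t,θ) differentiable for each θ. Assume that for each t and θ the integrand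 θ' ↦ κ(θ,θ',ρ_t)·P(θ,θ',ρ_t)·(∇log ρ_t(θ') − ∇log ρ_post(θ'))·ρ_t(θ') is integrable, that the vector field w_t(θ) := ρ_t(θ)·∫ κ(θ,θ',ρ_t)·P(θ,θ',ρ_t)·(∇log ρ_t(θ') − ∇log ρ_post(θ'))·ρ_t(θ') dθ' is continuously differentiable in θ, and that ∂_t ρ_t(θ) = div_θ w_t(θ) for all t, θ (the preconditioned Stein gradient flow of the KL divergence). Define ρ̃_t := φ#ρ_t and ρ̃_post := φ#ρ_post. Then for all t and θ̃, ∂_t ρ̃_t(θ̃) = div_{θ̃}( ρ̃_t(θ̃)·∫ κ(θ̃,θ̃',ρ̃_t)·P(θ̃,θ̃',ρ̃_t)·(∇log ρ̃_t(θ̃') − ∇log ρ̃_post(θ̃'))·ρ̃_t(θ̃') dθ̃' ); i.e. the preconditioned Stein gradient flow is affine invariant. -/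
open MeasureTheory

/-- The divergence of a vector field on `ℝ^d`. -/
noncomputable def divv {d : ℕ} (v : (Fin d → ℝ) → (Fin d → ℝ)) (θ : Fin d → ℝ) : ℝ :=
  ∑ i, fderiv ℝ (fun x => v x i) θ (Pi.single i 1)

section AffineChange

variable {d : ℕ} {A : Matrix (Fin d) (Fin d) ℝ}

/-- Multiplication by an invertible matrix as a continuous linear equivalence of `ℝ^d`. -/
noncomputable def mulVecEquiv (A : Matrix (Fin d) (Fin d) ℝ) (hA : IsUnit A.det) :
    (Fin d → ℝ) ≃L[ℝ] (Fin d → ℝ) where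
  toFun := A.mulVec
  invFun := A⁻¹.mulVec
  map_add' := A.mulVec_add
  map_smul' c x := A.mulVec_smul c x
  left_inv x := by simp [Matrix.nonsing_inv_mul _ hA]
  right_inv x := by simp [Matrix.mul_nonsing_inv _ hA]
  continuous_toFun := by fun_prop
  continuous_invFun := by fun_prop

@[simp]
theorem mulVecEquiv_apply (hA : IsUnit A.det) (x : Fin d → ℝ) :
    mulVecEquiv A hA x = A.mulVec x := rfl

theorem pushfwd_mulVec_add (hA : IsUnit A.det) (b : Fin d → ℝ) (ρ : (Fin d → ℝ) → ℝ)
    (θ : Fin d → ℝ) : pushfwd A b ρ (A.mulVec θ + b) = ρ θ * |A.det|⁻¹ := by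
  simp [pushfwd, Matrix.nonsing_inv_mul _ hA]

theorem integral_comp_mulVec_add {E : Type*} [NormedAddCommGroup E] [NormedSpace ℝ E]
    (hA : IsUnit A.det) (b : Fin d → ℝ) (g : (Fin d → ℝ) → E) :
    ∫ y, g y = ∫ θ, |A.det| • g (A.mulVec θ + b) := by
  have h0 : A.det ≠ 0 := hA.ne_zero
  have h := integral_map_equiv (μ := volume)
    (mulVecEquiv A hA).toHomeomorph.toMeasurableEquiv (fun y => g (y + b))
  have hmap : Measure.map (mulVecEquiv A hA).toHomeomorph.toMeasurableEquiv volume =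
      ENNReal.ofReal |A.det⁻¹| • volume :=
    Real.map_matrix_volume_pi_eq_smul_volume_pi h0
  rw [hmap, integral_smul_measure, integral_add_right_eq_self,
    ENNReal.toReal_ofReal (abs_nonneg _), abs_inv] at h
  rw [integral_smul, ← inv_smul_eq_iff₀ (abs_ne_zero.mpr h0)]
  exact h

theorem gradv_comp_mulVec_add (hA : IsUnit A.det) (b : Fin d → ℝ) (g : (Fin d → ℝ) → ℝ)
    (θ : Fin d → ℝ) :
    gradv (fun x => g (A.mulVec x + b)) θ = A.transpose.mulVec (gradv g (A.mulVec θ + b)) := by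
  have h := (mulVecEquiv A hA).comp_right_fderiv (f := fun y => g (y + b)) (x := θ)
  rw [fderiv_comp_add_right] at h
  have h' : fderiv ℝ (fun x => g (A.mulVec x + b)) θ =
    (fderiv ℝ g (A.mulVec θ + b)).comp ((mulVecEquiv A hA) : (Fin d → ℝ) →L[ℝ] (Fin d → ℝ)) := h
  ext i
  have hcol : A.mulVec (Pi.single i 1) = ∑ j, A j i • (Pi.single j 1 : Fin d → ℝ) := by
    rw [Matrix.mulVec_single_one, ← pi_eq_sum_univ']
    rfl
  simp [gradv, h', hcol, Matrix.mulVec, dotProduct]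

theorem gradv_log_pushfwd (hA : IsUnit A.det) (b : Fin d → ℝ) {ρ : (Fin d → ℝ) → ℝ}
    (hρ : ∀ θ, 0 < ρ θ) (θ : Fin d → ℝ) :
    A.transpose.mulVec (gradv (fun z => Real.log (pushfwd A b ρ z)) (A.mulVec θ + b)) =
      gradv (fun x => Real.log (ρ x)) θ := by
  rw [← gradv_comp_mulVec_add hA b]
  have h0 : |A.det|⁻¹ ≠ 0 := inv_ne_zero (abs_ne_zero.mpr hA.ne_zero)
  simp only [pushfwd_mulVec_add hA, Real.log_mul (hρ _).ne' h0]
  ext i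
  simp only [gradv, fderiv_add_const]

theorem divv_eq_trace {v : (Fin d → ℝ) → (Fin d → ℝ)} {θ : Fin d → ℝ}
    (hv : DifferentiableAt ℝ v θ) :
    divv v θ = LinearMap.trace ℝ _ (fderiv ℝ v θ : (Fin d → ℝ) →ₗ[ℝ] (Fin d → ℝ)) := by
  rw [LinearMap.trace_eq_matrix_trace ℝ (Pi.basisFun ℝ (Fin d))]
  simp [divv, Matrix.trace, fderiv_apply hv]

theorem divv_smul_mulVec_comp (hA : IsUnit A.det) (b : Fin d → ℝ) (c : ℝ)
    {v : (Fin d → ℝ) → (Fin d → ℝ)} (hv : Differentiable ℝ v) (x : Fin d → ℝ) :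
    divv (fun x => c • A.mulVec (v (A⁻¹.mulVec (x - b)))) x =
      c * divv v (A⁻¹.mulVec (x - b)) := by
  let e := mulVecEquiv A hA
  have hin : HasFDerivAt (fun x => A⁻¹.mulVec (x - b))
      (e.symm : (Fin d → ℝ) →L[ℝ] (Fin d → ℝ)) x :=
    e.symm.hasFDerivAt.comp x ((hasFDerivAt_id x).sub_const b)
  have h : HasFDerivAt (fun x => c • A.mulVec (v (A⁻¹.mulVec (x - b))))
      (c • (e : (Fin d → ℝ) →L[ℝ] (Fin d → ℝ)).comp
        ((fderiv ℝ v (A⁻¹.mulVec (x - b))).comp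
          (e.symm : (Fin d → ℝ) →L[ℝ] (Fin d → ℝ)))) x :=
    (e.hasFDerivAt.comp x ((hv _).hasFDerivAt.comp x hin)).const_smul c
  rw [divv_eq_trace h.differentiableAt, divv_eq_trace (hv _), h.fderiv,
    ← LinearMap.trace_conj'
      (fderiv ℝ v (A⁻¹.mulVec (x - b)) : (Fin d → ℝ) →ₗ[ℝ] (Fin d → ℝ)) e.toLinearEquiv,
    ← smul_eq_mul, ← map_smul]
  rfl

end AffineChange

/-- Affine invariance of the preconditioned Stein gradient flow of the KL divergence:
if `κ·P` transforms as `κ(φθ,φθ',φ#ρ)·P(φθ,φθ',φ#ρ) = κ(θ,θ',ρ)·A·P(θ,θ',ρ)·Aᵀ` under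
`φ(θ) = Aθ + b`, and `ρ_t` solves the preconditioned Stein flow, then the pushforward
`ρ̃_t = φ#ρ_t` solves the same equation with target `ρ̃_post = φ#ρ_post`. -/
theorem preconditioned_stein_flow_affine_invariant {d : ℕ}
    (A : Matrix (Fin d) (Fin d) ℝ) (hA : IsUnit A.det) (b : Fin d → ℝ)
    (κ : (Fin d → ℝ) → (Fin d → ℝ) → ((Fin d → ℝ) → ℝ) → ℝ)
    (P : (Fin d → ℝ) → (Fin d → ℝ) → ((Fin d → ℝ) → ℝ) → Matrix (Fin d) (Fin d) ℝ)
    (hκP : ∀ θ θ' ρ, IsPosDensity ρ →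
      κ (A.mulVec θ + b) (A.mulVec θ' + b) (pushfwd A b ρ) •
          P (A.mulVec θ + b) (A.mulVec θ' + b) (pushfwd A b ρ) =
        κ θ θ' ρ • (A * P θ θ' ρ * A.transpose))
    (ρpost : (Fin d → ℝ) → ℝ) (hpostC2 : ContDiff ℝ 2 ρpost)
    (hpostdens : IsPosDensity ρpost)
    (ρ : ℝ → (Fin d → ℝ) → ℝ)
    (hρdens : ∀ t, IsPosDensity (ρ t))
    (hρC1 : ∀ t, ContDiff ℝ 1 (ρ t))
    (hInt : ∀ t θ, Integrable (fun θ' => ρ t θ' •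
      (κ θ θ' (ρ t) • P θ θ' (ρ t)).mulVec
        (gradv (fun x => Real.log (ρ t x)) θ' - gradv (fun x => Real.log (ρpost x)) θ')))
    (w : ℝ → (Fin d → ℝ) → (Fin d → ℝ))
    (hw : ∀ t θ, w t θ = ρ t θ • ∫ θ', ρ t θ' •
      (κ θ θ' (ρ t) • P θ θ' (ρ t)).mulVec
        (gradv (fun x => Real.log (ρ t x)) θ' - gradv (fun x => Real.log (ρpost x)) θ'))
    (hwC1 : ∀ t, ContDiff ℝ 1 (w t))
    (hflow : ∀ t θ, HasDerivAt (fun s => ρ s θ) (divv (w t) θ) t) :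
    ∀ t θ', HasDerivAt (fun s => pushfwd A b (ρ s) θ')
      (divv (fun x => pushfwd A b (ρ t) x • ∫ y, pushfwd A b (ρ t) y •
        (κ x y (pushfwd A b (ρ t)) • P x y (pushfwd A b (ρ t))).mulVec
          (gradv (fun z => Real.log (pushfwd A b (ρ t) z)) y -
            gradv (fun z => Real.log (pushfwd A b ρpost z)) y)) θ') t := by
  intro t x
  have h0 : |A.det| ≠ 0 := abs_ne_zero.mpr hA.ne_zero
  have hfield : ∀ θ, pushfwd A b (ρ t) (A.mulVec θ + b) • ∫ y, pushfwd A b (ρ t) y •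
        (κ (A.mulVec θ + b) y (pushfwd A b (ρ t)) •
          P (A.mulVec θ + b) y (pushfwd A b (ρ t))).mulVec
          (gradv (fun z => Real.log (pushfwd A b (ρ t) z)) y -
            gradv (fun z => Real.log (pushfwd A b ρpost z)) y) =
      |A.det|⁻¹ • A.mulVec (w t θ) := by
    intro θ
    rw [integral_comp_mulVec_add hA b, hw, Matrix.mulVec_smul, ← mulVecEquiv_apply hA (∫ _, _),
      ← ContinuousLinearEquiv.integral_comp_comm, pushfwd_mulVec_add hA, mul_comm, mul_smul]
    congr! 4 with y
    rw [hκP _ _ _ (hρdens t), pushfwd_mulVec_add hA, smul_smul, mul_left_comm,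
      mul_inv_cancel₀ h0, mul_one, ← Matrix.smul_mul, ← Matrix.mul_smul, ← Matrix.mulVec_mulVec,
      Matrix.mulVec_sub, gradv_log_pushfwd hA b (hρdens t).1, gradv_log_pushfwd hA b hpostdens.1,
      ← Matrix.mulVec_mulVec, map_smul, mulVecEquiv_apply]
  have hx : ∀ x, A.mulVec (A⁻¹.mulVec (x - b)) + b = x := by
    simp [Matrix.mul_nonsing_inv _ hA]
  have hfun := funext fun x => hfield (A⁻¹.mulVec (x - b))
  simp only [hx] at hfun
  rw [hfun, divv_smul_mulVec_comp hA b _ ((hwC1 t).differentiable one_ne_zero), mul_comm]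
  exact (hflow t _).mul_const _
end
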